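/- Let K, P be n-polytopes in ℝ^n such that: (1) the support of S(P,·) equals the support of S(K,·); (2) there exists a constant λ > 0 with V(L,P[n−1]) ≤ λ·V(L,K[n−1]) for all convex bodies L in ℝ^n; and (3) V(K,P[n−1]) = λ·V_n(K). Then S(P,·) = λ·S(K,·) as measures on the unit sphere. -/

import Mathlib

open Pointwise MeasureTheory RealInnerProductSpace

/-- The mixed volume of an `n`-tuple of sets in `ℝⁿ`, via the polarization formula. -/
noncomputable def mixedVol (n : ℕ) (K : Fin n → Set (EuclideanSpace ℝ (Fin n))) : ℝ :=
  ((n.factorial : ℝ))⁻¹ *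
    ∑ S : Finset (Fin n), (-1 : ℝ) ^ (n - S.card) * (volume (∑ i ∈ S, K i)).toReal

/-- A convex body: a nonempty compact convex set. -/
def IsConvexBody {n : ℕ} (K : Set (EuclideanSpace ℝ (Fin n))) : Prop :=
  Convex ℝ K ∧ IsCompact K ∧ K.Nonempty

/-- The support function `h_K(u) = sup {⟨x,u⟩ : x ∈ K}`. -/
noncomputable def suppFn {n : ℕ} (K : Set (EuclideanSpace ℝ (Fin n)))
    (u : EuclideanSpace ℝ (Fin n)) : ℝ :=
  sSup ((fun x => ⟪x, u⟫) '' K)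

/-- The support of a measure: points all of whose open neighborhoods have nonzero measure. -/
def msupport {α : Type*} [TopologicalSpace α] [MeasurableSpace α] (μ : Measure α) : Set α :=
  {x | ∀ U : Set α, IsOpen U → x ∈ U → μ U ≠ 0}

/-- A measure `μ` on the unit sphere is the surface area measure `S(P,·)` of `P` if
`V(L,P[n-1]) = (1/n) ∫ h_L dμ` for every convex body `L`. -/
def IsSurfaceAreaMeasure (n : ℕ) (P : Set (EuclideanSpace ℝ (Fin n)))
    (μ : Measure (Metric.sphere (0 : EuclideanSpace ℝ (Fin n)) 1)) : Prop :=
  ∀ L : Set (EuclideanSpace ℝ (Fin n)), IsConvexBody L →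
    mixedVol n (fun j : Fin n => if (j : ℕ) = 0 then L else P)
      = (1 / n) * ∫ w : Metric.sphere (0 : EuclideanSpace ℝ (Fin n)) 1,
          suppFn L (w : EuclideanSpace ℝ (Fin n)) ∂μ

lemma bddAbove_inner_image {n : ℕ} {K : Set (EuclideanSpace ℝ (Fin n))} (hK : IsCompact K)
    (u : EuclideanSpace ℝ (Fin n)) : BddAbove ((fun x => ⟪x, u⟫) '' K) :=
  (hK.image (by fun_prop)).bddAbove

lemma inner_le_suppFn {n : ℕ} {K : Set (EuclideanSpace ℝ (Fin n))} (hK : IsCompact K)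
    {x : EuclideanSpace ℝ (Fin n)} (hx : x ∈ K) (u : EuclideanSpace ℝ (Fin n)) :
    ⟪x, u⟫ ≤ suppFn K u :=
  le_csSup (bddAbove_inner_image hK u) ⟨x, hx, rfl⟩

lemma suppFn_le {n : ℕ} {K : Set (EuclideanSpace ℝ (Fin n))} (hK : K.Nonempty)
    {u : EuclideanSpace ℝ (Fin n)} {c : ℝ} (h : ∀ x ∈ K, ⟪x, u⟫ ≤ c) : suppFn K u ≤ c :=
  csSup_le (hK.image _) (by rintro _ ⟨x, hx, rfl⟩; exact h x hx)

lemma exists_inner_eq_suppFn {n : ℕ} {K : Set (EuclideanSpace ℝ (Fin n))} (hK : IsCompact K)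
    (hne : K.Nonempty) (u : EuclideanSpace ℝ (Fin n)) : ∃ x ∈ K, ⟪x, u⟫ = suppFn K u := by
  have := (hK.image (f := fun x => ⟪x, u⟫) (by fun_prop)).sSup_mem (hne.image _)
  exact this

lemma continuous_suppFn {n : ℕ} {K : Set (EuclideanSpace ℝ (Fin n))} (hK : IsCompact K) :
    Continuous (suppFn K) :=
  hK.continuous_sSup (f := fun u x => ⟪x, u⟫) (by fun_prop)

lemma integrable_suppFn {n : ℕ} {K : Set (EuclideanSpace ℝ (Fin n))} (hK : IsCompact K)
    (μ : Measure (Metric.sphere (0 : EuclideanSpace ℝ (Fin n)) 1)) [IsFiniteMeasure μ] :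
    Integrable (fun w : Metric.sphere (0 : EuclideanSpace ℝ (Fin n)) 1 =>
      suppFn K (w : EuclideanSpace ℝ (Fin n))) μ :=
  ((continuous_suppFn hK).comp continuous_subtype_val).integrable_of_hasCompactSupport
    (HasCompactSupport.of_compactSpace _)

lemma suppFn_smul {n : ℕ} (K : Set (EuclideanSpace ℝ (Fin n))) {t : ℝ} (ht : 0 ≤ t)
    (u : EuclideanSpace ℝ (Fin n)) : suppFn (t • K) u = t * suppFn K u := by
  have : (fun x => ⟪x, u⟫) '' (t • K) = t • ((fun x => ⟪x, u⟫) '' K) := by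
    ext y
    simp [Set.mem_smul_set, inner_smul_left]
  rw [suppFn, this, Real.sSup_smul_of_nonneg ht, smul_eq_mul, suppFn]

lemma isLinearMap_inner_left {n : ℕ} (u : EuclideanSpace ℝ (Fin n)) :
    IsLinearMap ℝ fun x : EuclideanSpace ℝ (Fin n) => ⟪x, u⟫ :=
  ⟨fun x y => inner_add_left x y u, fun c x => real_inner_smul_left x u c⟩

lemma suppFn_convexHull_insert {n : ℕ} {s : Set (EuclideanSpace ℝ (Fin n))} (hs : s.Finite)
    (hne : s.Nonempty) (p u : EuclideanSpace ℝ (Fin n)) :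
    suppFn (convexHull ℝ (insert p s)) u = max (suppFn (convexHull ℝ s) u) ⟪p, u⟫ := by
  have hK := hs.isCompact_convexHull (𝕜 := ℝ)
  have hL := (hs.insert p).isCompact_convexHull (𝕜 := ℝ)
  refine le_antisymm (suppFn_le (Set.insert_nonempty p s).convexHull fun x hx => ?_)
    (max_le ?_ ?_)
  · refine convexHull_min ?_ (convex_halfSpace_le (isLinearMap_inner_left u) _) hx
    intro x hx
    rcases Set.mem_insert_iff.1 hx with rfl | hx
    · exact le_max_right (suppFn (convexHull ℝ s) u) _
    · exact (inner_le_suppFn hK (subset_convexHull ℝ _ hx) u).trans (le_max_left _ _)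
  · exact suppFn_le hne.convexHull fun x hx =>
      inner_le_suppFn hL (convexHull_mono (Set.subset_insert p s) hx) u
  · exact inner_le_suppFn hL (subset_convexHull ℝ _ (Set.mem_insert p s)) u

lemma sum_const_eq_smul {n : ℕ} {ι : Type*} {Q : Set (EuclideanSpace ℝ (Fin n))}
    (hQ : Convex ℝ Q) (hne : Q.Nonempty) (T : Finset ι) :
    ∑ _i ∈ T, Q = (T.card : ℝ) • Q := by
  classical
  induction T using Finset.induction_on with
  | empty => simp [Set.zero_smul_set hne]
  | insert i T hi ih =>
    rw [Finset.sum_insert hi, ih, Finset.card_insert_of_notMem hi, Nat.cast_add, Nat.cast_one,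
      add_comm (T.card : ℝ), hQ.add_smul zero_le_one (Nat.cast_nonneg _), one_smul]

lemma sum_ite_eq_add_smul {n : ℕ} (hn : 1 ≤ n) {Q : Set (EuclideanSpace ℝ (Fin n))}
    (hQ : Convex ℝ Q) (hne : Q.Nonempty) (S : Finset (Fin n)) :
    ∃ m : ℝ, 0 ≤ m ∧ m ≤ n ∧
      ((∀ L, (∑ i ∈ S, if (i : ℕ) = 0 then L else Q) = L + m • Q) ∨
        ∀ L, (∑ i ∈ S, if (i : ℕ) = 0 then L else Q) = m • Q) := by
  have key : ∀ T : Finset (Fin n), (⟨0, hn⟩ : Fin n) ∉ T → ∀ L : Set (EuclideanSpace ℝ (Fin n)),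
      (∑ i ∈ T, if (i : ℕ) = 0 then L else Q) = (T.card : ℝ) • Q := by
    intro T hT L
    rw [← sum_const_eq_smul hQ hne]
    refine Finset.sum_congr rfl fun i hi => if_neg fun h0 => hT ?_
    rwa [show (⟨0, hn⟩ : Fin n) = i from Fin.ext h0.symm]
  have hcard : ∀ T : Finset (Fin n), (T.card : ℝ) ≤ n := fun T => by
    exact_mod_cast (Finset.card_le_univ T).trans_eq (Fintype.card_fin n)
  by_cases h : (⟨0, hn⟩ : Fin n) ∈ S
  · refine ⟨(S.erase ⟨0, hn⟩).card, Nat.cast_nonneg _, hcard _, Or.inl fun L => ?_⟩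
    rw [← Finset.add_sum_erase _ _ h, key _ (Finset.notMem_erase _ _)]
    simp
  · exact ⟨S.card, Nat.cast_nonneg _, hcard _, Or.inr (key S h)⟩

lemma sum_neg_one_pow_mul_card_pow (n : ℕ) :
    ∑ S : Finset (Fin n), (-1 : ℝ) ^ (n - S.card) * (S.card : ℝ) ^ n = n.factorial := by
  have h := congrFun (fwdDiff_iter_eq_factorial (R := ℝ) (n := n)) 0
  rw [fwdDiff_iter_eq_sum_shift] at h
  rw [← Finset.powerset_univ,
    Finset.sum_powerset_apply_card (fun k => (-1 : ℝ) ^ (n - k) * (k : ℝ) ^ n)]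
  simp only [Finset.card_univ, Fintype.card_fin]
  refine Eq.trans (Finset.sum_congr rfl fun k _ => ?_) (h.trans (by simp))
  simp
  ring

lemma mixedVol_self {n : ℕ} {K : Set (EuclideanSpace ℝ (Fin n))}
    (hK : Convex ℝ K) (hne : K.Nonempty) :
    mixedVol n (fun _ => K) = (volume K).toReal := by
  have : ∀ S : Finset (Fin n), (-1 : ℝ) ^ (n - S.card) * (volume (∑ _i ∈ S, K)).toReal =
      (-1 : ℝ) ^ (n - S.card) * (S.card : ℝ) ^ n * (volume K).toReal := by
    intro S
    rw [sum_const_eq_smul hK hne, Measure.addHaar_smul, finrank_euclideanSpace_fin,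
      ENNReal.toReal_mul, ENNReal.toReal_ofReal (abs_nonneg _), abs_of_nonneg (by positivity),
      mul_assoc]
  simp only [mixedVol, this]
  rw [← Finset.sum_mul, sum_neg_one_pow_mul_card_pow, inv_mul_cancel_left₀]
  positivity

lemma mixedVol_singleton_add {n : ℕ} (hn : 1 ≤ n) (c : EuclideanSpace ℝ (Fin n))
    (L : Set (EuclideanSpace ℝ (Fin n))) {Q : Set (EuclideanSpace ℝ (Fin n))}
    (hQ : Convex ℝ Q) (hne : Q.Nonempty) :
    mixedVol n (fun j : Fin n => if (j : ℕ) = 0 then {c} + L else Q) =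
      mixedVol n (fun j : Fin n => if (j : ℕ) = 0 then L else Q) := by
  unfold mixedVol
  congr 1
  refine Finset.sum_congr rfl fun S _ => ?_
  obtain ⟨m, -, -, h | h⟩ := sum_ite_eq_add_smul hn hQ hne S
  · rw [h, h, add_assoc, Set.singleton_add, Set.image_add_left, measure_preimage_add]
  · rw [h, h]

lemma exists_suppFn_translate_pos {n : ℕ} {K : Set (EuclideanSpace ℝ (Fin n))}
    (hK : IsConvexBody K) (hint : (interior K).Nonempty) :
    ∃ c : EuclideanSpace ℝ (Fin n), IsConvexBody ({c} + K) ∧ ∃ r > 0,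
      ∀ u : EuclideanSpace ℝ (Fin n), ‖u‖ = 1 → r ≤ suppFn ({c} + K) u := by
  obtain ⟨x, hx⟩ := hint
  obtain ⟨r, hr, hball⟩ := Metric.nhds_basis_closedBall.mem_iff.1 (mem_interior_iff_mem_nhds.1 hx)
  have hbody : IsConvexBody ({-x} + K) :=
    ⟨(convex_singleton _).add hK.1, isCompact_singleton.add hK.2.1,
      (Set.singleton_nonempty _).add hK.2.2⟩
  refine ⟨-x, hbody, r, hr, fun u hu => ?_⟩
  have hmem : r • u ∈ ({-x} + K : Set (EuclideanSpace ℝ (Fin n))) := by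
    refine Set.mem_add.2 ⟨-x, rfl, x + r • u, hball ?_, by simp⟩
    simp [norm_smul, hu, abs_of_pos hr]
  have := inner_le_suppFn hbody.2.1 hmem u
  simpa [real_inner_smul_left, real_inner_self_eq_norm_sq, hu] using this

lemma IsSurfaceAreaMeasure.isFiniteMeasure {n : ℕ} (hn : 1 ≤ n)
    {K : Set (EuclideanSpace ℝ (Fin n))} (hK : IsConvexBody K) (hint : (interior K).Nonempty)
    {μ : Measure (Metric.sphere (0 : EuclideanSpace ℝ (Fin n)) 1)}
    (hμ : IsSurfaceAreaMeasure n K μ) : IsFiniteMeasure μ := by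
  obtain ⟨c, hbody, r, hr, hpos⟩ := exists_suppFn_translate_pos hK hint
  have h := hμ _ hbody
  rw [mixedVol_singleton_add hn c K hK.1 hK.2.2] at h
  simp only [ite_self] at h
  rw [mixedVol_self hK.1 hK.2.2] at h
  have hvol : 0 < (volume K).toReal :=
    ENNReal.toReal_pos (Measure.measure_pos_of_nonempty_interior _ hint).ne' hK.2.1.measure_lt_top.ne
  have hI : Integrable (fun w : Metric.sphere (0 : EuclideanSpace ℝ (Fin n)) 1 =>
      suppFn ({c} + K) (w : EuclideanSpace ℝ (Fin n))) μ := by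
    by_contra hI
    rw [integral_undef hI] at h
    simp at h
    linarith
  have hconst : Integrable (fun _ : Metric.sphere (0 : EuclideanSpace ℝ (Fin n)) 1 => r) μ :=
    hI.mono' (by fun_prop) (Filter.Eventually.of_forall fun w => by
      rw [Real.norm_of_nonneg hr.le]
      exact hpos _ (by simp))
  exact (integrable_const_iff_isFiniteMeasure hr.ne').1 hconst

lemma measure_compl_msupport {α : Type*} [TopologicalSpace α] [SecondCountableTopology α]
    [MeasurableSpace α] (μ : Measure α) : μ (msupport μ)ᶜ = 0 := by
  refine measure_null_of_locally_null _ fun x hx => ?_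
  simp only [msupport, Set.mem_compl_iff, Set.mem_ofPred_eq, not_forall, not_not] at hx
  obtain ⟨U, hU, hxU, h0⟩ := hx
  exact ⟨U, mem_nhdsWithin_of_mem_nhds (hU.mem_nhds hxU), h0⟩

lemma exists_volume_slab_le {n : ℕ} {u w : EuclideanSpace ℝ (Fin n)} (hu : ‖u‖ = 1)
    (hw : ‖w‖ = 1) (huw : ⟪u, w⟫ = 0) (R : ℝ) (hR : 0 ≤ R) :
    ∃ C : ℝ, ∀ a b t : ℝ, 0 ≤ t →
      (volume {y : EuclideanSpace ℝ (Fin n) | ‖y‖ ≤ R ∧ |⟪y, u⟫ - a| ≤ t ∧ |⟪y, w⟫ - b| ≤ t}).toReal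
        ≤ C * t ^ 2 := by
  classical
  have hn : 2 ≤ n := by
    have ho : Orthonormal ℝ ![u, w] := by
      rw [orthonormal_iff_ite]
      intro i j
      fin_cases i <;> fin_cases j <;>
        simp [hu, hw, huw, real_inner_comm u w ▸ huw]
    simpa using ho.linearIndependent.fintype_card_le_finrank
  let i : Fin n := ⟨0, by omega⟩
  let j : Fin n := ⟨1, by omega⟩
  have hij : i ≠ j := by simp [i, j]
  let v : Fin n → EuclideanSpace ℝ (Fin n) := fun k => if k = i then u else w
  have hv : Orthonormal ℝ (({i, j} : Set (Fin n)).domRestrict v) := by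
    rw [orthonormal_iff_ite]
    rintro ⟨k, rfl | rfl⟩ ⟨l, rfl | rfl⟩ <;>
      simp [v, hu, hw, huw, real_inner_comm u w ▸ huw, hij.symm]
    · exact fun h => hij (congrArg Subtype.val h)
    · exact fun h => hij (congrArg Subtype.val h).symm
  obtain ⟨b', hb'⟩ := hv.exists_orthonormalBasis_extension_of_card_eq (by simp)
  have hbi : b' i = u := by rw [hb' i (by simp)]; simp [v]
  have hbj : b' j = w := by rw [hb' j (by simp)]; simp [v, hij.symm]
  refine ⟨4 * ∏ _k ∈ (Finset.univ.erase i).erase j, 2 * R, fun a b t ht => ?_⟩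
  let lo : Fin n → ℝ := fun k => if k = i then a - t else if k = j then b - t else -R
  let hi : Fin n → ℝ := fun k => if k = i then a + t else if k = j then b + t else R
  have hlohi : lo ≤ hi := by
    intro k
    simp only [lo, hi]
    split_ifs <;> linarith
  have hmp := (EuclideanSpace.volume_preserving_symm_measurableEquiv_toLp (Fin n)).comp
    b'.measurePreserving_repr
  have hsub : {y : EuclideanSpace ℝ (Fin n) | ‖y‖ ≤ R ∧ |⟪y, u⟫ - a| ≤ t ∧ |⟪y, w⟫ - b| ≤ t} ⊆
      ((MeasurableEquiv.toLp 2 (Fin n → ℝ)).symm ∘ b'.repr) ⁻¹' Set.Icc lo hi := by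
    rintro y ⟨h1, h2, h3⟩
    rw [abs_le] at h2 h3
    have hcoord : ∀ k, ((MeasurableEquiv.toLp 2 (Fin n → ℝ)).symm ∘ b'.repr) y k = ⟪y, b' k⟫ := by
      intro k
      rw [real_inner_comm]
      exact b'.repr_apply_apply y k
    have hle : ∀ k, |⟪y, b' k⟫| ≤ R := fun k =>
      (abs_real_inner_le_norm _ _).trans (by simpa using h1)
    simp only [Set.mem_preimage, Set.mem_Icc, Pi.le_def, hcoord, ← forall_and]
    intro k
    simp only [lo, hi]
    split_ifs with hk hk
    · subst hk; rw [hbi]; constructor <;> linarith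
    · subst hk; rw [hbj]; constructor <;> linarith
    · exact abs_le.1 (hle k)
  have hvol := hmp.measure_preimage (s := Set.Icc lo hi) measurableSet_Icc.nullMeasurableSet
  calc _ ≤ (volume (((MeasurableEquiv.toLp 2 (Fin n → ℝ)).symm ∘ b'.repr) ⁻¹' Set.Icc lo hi)).toReal :=
        ENNReal.toReal_mono (by rw [hvol]; exact isCompact_Icc.measure_lt_top.ne)
          (measure_mono hsub)
    _ = ∏ k, (hi k - lo k) := by rw [hvol, Real.volume_Icc_pi_toReal hlohi]
    _ = (2 * t) * ((2 * t) * ∏ _k ∈ (Finset.univ.erase i).erase j, 2 * R) := by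
        rw [← Finset.mul_prod_erase _ _ (Finset.mem_univ i),
          ← Finset.mul_prod_erase _ _ (show j ∈ Finset.univ.erase i by simp [hij.symm])]
        congr 1
        · simp [lo, hi]; ring
        congr 1
        · simp [lo, hi, hij.symm]; ring
        refine Finset.prod_congr rfl fun k hk => ?_
        simp only [Finset.mem_erase, Finset.mem_univ, and_true] at hk
        simp [lo, hi, hk.1, hk.2]; ring
    _ ≤ _ := le_of_eq (by ring)

lemma exists_mem_inner_lt_suppFn {n : ℕ} {K : Set (EuclideanSpace ℝ (Fin n))}
    (hK : IsCompact K) (hint : (interior K).Nonempty) {u : EuclideanSpace ℝ (Fin n)}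
    (hu : ‖u‖ = 1) : ∃ x ∈ K, ⟪x, u⟫ < suppFn K u := by
  obtain ⟨x, hx⟩ := hint
  obtain ⟨r, hr, hball⟩ := Metric.nhds_basis_closedBall.mem_iff.1 (mem_interior_iff_mem_nhds.1 hx)
  have hmem : x + r • u ∈ K := hball (by simp [norm_smul, hu, abs_of_pos hr])
  refine ⟨x, interior_subset hx, ?_⟩
  have := inner_le_suppFn hK hmem u
  rw [inner_add_left, real_inner_smul_left, real_inner_self_eq_norm_sq, hu] at this
  linarith

lemma exists_vertex_inner_eq_suppFn {n : ℕ} {s : Finset (EuclideanSpace ℝ (Fin n))}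
    (hs : s.Nonempty) (u : EuclideanSpace ℝ (Fin n)) :
    ∃ a ∈ s, ⟪a, u⟫ = suppFn (convexHull ℝ (s : Set (EuclideanSpace ℝ (Fin n)))) u := by
  have hK := s.finite_toSet.isCompact_convexHull (𝕜 := ℝ)
  by_contra! h
  obtain ⟨x, hx, hxu⟩ := exists_inner_eq_suppFn hK (Finset.coe_nonempty.2 hs).convexHull u
  have hlt : ∀ y ∈ convexHull ℝ (s : Set (EuclideanSpace ℝ (Fin n))),
      ⟪y, u⟫ < suppFn (convexHull ℝ (s : Set (EuclideanSpace ℝ (Fin n)))) u := fun y hy =>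
    convexHull_min (fun a ha => lt_of_le_of_ne
      (inner_le_suppFn hK (subset_convexHull ℝ _ ha) u) (h a ha))
      (convex_halfSpace_lt (isLinearMap_inner_left u) _) hy
  exact (hlt x hx).ne hxu

/-- If the vertices of a polytope are split into those on the face with normal `u` and the
others, and the face has codimension at least two, then replacing the polytope by the hull `L` of
the other vertices changes the volumes entering the mixed volume only to second order. -/
lemma exists_volume_sub_le {n : ℕ} {K L F : Set (EuclideanSpace ℝ (Fin n))}
    (hK : IsConvexBody K) (hL : IsCompact L) (hLK : L ⊆ K) (hFK : F ⊆ K)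
    (hdec : ∀ k ∈ K, ∃ f ∈ F, ∃ g ∈ L, ∃ θ : ℝ, 0 ≤ θ ∧ θ ≤ 1 ∧ k = (1 - θ) • f + θ • g)
    {u w : EuclideanSpace ℝ (Fin n)} (hu : ‖u‖ = 1) (hw : ‖w‖ = 1) (huw : ⟪u, w⟫ = 0)
    {a b : ℝ} (hFu : ∀ f ∈ F, ⟪f, u⟫ = a) (hFw : ∀ f ∈ F, ⟪f, w⟫ = b) :
    ∃ C : ℝ, 0 ≤ C ∧ ∀ t m : ℝ, 0 ≤ t → t ≤ 1 → 0 ≤ m → m ≤ n →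
      |(volume (t • K + m • K)).toReal - (volume (t • L + m • K)).toReal| ≤ C * t ^ 2 := by
  obtain ⟨R, hR⟩ := hK.2.1.isBounded.exists_norm_le
  have hR0 : 0 ≤ R := hK.2.2.elim fun x hx => (norm_nonneg x).trans (hR x hx)
  obtain ⟨C, hC⟩ := exists_volume_slab_le hu hw huw ((1 + n) * R) (by positivity)
  set D := R + |a| + |b|
  have hD : 0 ≤ D := by positivity
  have hbound : ∀ v : EuclideanSpace ℝ (Fin n), ‖v‖ = 1 → ∀ c : ℝ, |c| ≤ |a| + |b| →
      ∀ g ∈ L, |⟪g, v⟫ - c| ≤ D := by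
    intro v hv c hc g hg
    have h1 := abs_real_inner_le_norm g v
    rw [hv, mul_one] at h1
    have := hR g (hLK hg)
    calc _ ≤ |⟪g, v⟫| + |c| := abs_sub _ _
      _ ≤ D := by simp only [D]; linarith
  refine ⟨|C * D ^ 2|, abs_nonneg _, fun t m ht ht1 hm hmn => ?_⟩
  have hsub : t • L + m • K ⊆ t • K + m • K := Set.add_subset_add_right (Set.smul_set_mono hLK)
  have hcK : IsCompact (t • K + m • K) := (hK.2.1.smul t).add (hK.2.1.smul m)
  have hcL : IsCompact (t • L + m • K) := (hL.smul t).add (hK.2.1.smul m)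
  have hdiff := measureReal_sdiff (μ := volume) hsub hcL.measurableSet hcK.measure_lt_top.ne
  simp only [Measure.real] at hdiff
  rw [← hdiff, abs_of_nonneg ENNReal.toReal_nonneg]
  have hslab : (t • K + m • K) \ (t • L + m • K) ⊆
      {y | ‖y‖ ≤ (1 + n) * R ∧ |⟪y, u⟫ - (t + m) * a| ≤ D * t ∧
        |⟪y, w⟫ - (t + m) * b| ≤ D * t} := by
    rintro y ⟨hy, hyL⟩
    rw [← hK.1.add_smul ht hm] at hy
    obtain ⟨k, hk, rfl⟩ := hy
    obtain ⟨f, hf, g, hg, θ, hθ0, hθ1, rfl⟩ := hdec k hk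
    have htm : 0 ≤ t + m := by positivity
    have hθ : (t + m) * θ < t := by
      by_contra! hθ
      refine hyL (Set.mem_add.2 ⟨t • g, Set.smul_mem_smul_set hg,
        ((t + m) * (1 - θ)) • f + ((t + m) * θ - t) • g, ?_, by module⟩)
      rw [show m = (t + m) * (1 - θ) + ((t + m) * θ - t) by ring,
        hK.1.add_smul (mul_nonneg htm (by linarith)) (by linarith)]
      convert Set.add_mem_add (Set.smul_mem_smul_set (a := (t + m) * (1 - θ)) (hFK hf))
        (Set.smul_mem_smul_set (a := (t + m) * θ - t) (hLK hg)) using 2 <;> ring_nf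
    have hdist : ∀ v : EuclideanSpace ℝ (Fin n), ‖v‖ = 1 → ∀ c : ℝ, |c| ≤ |a| + |b| →
        ⟪f, v⟫ = c → |⟪(t + m) • ((1 - θ) • f + θ • g), v⟫ - (t + m) * c| ≤ D * t := by
      intro v hv c hc hfc
      have : ⟪(t + m) • ((1 - θ) • f + θ • g), v⟫ - (t + m) * c =
          ((t + m) * θ) * (⟪g, v⟫ - c) := by
        simp only [inner_add_left, real_inner_smul_left, hfc]
        ring
      rw [this, abs_mul, abs_of_nonneg (by positivity), mul_comm]
      exact mul_le_mul (hbound v hv c hc g hg) hθ.le (by positivity) hD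
    refine ⟨?_, hdist u hu a (by simp) (hFu f hf), hdist w hw b (by simp) (hFw f hf)⟩
    rw [norm_smul, Real.norm_of_nonneg htm]
    exact mul_le_mul (by linarith) (hR _ hk) (norm_nonneg _) (by positivity)
  have hbdd : Bornology.IsBounded {y : EuclideanSpace ℝ (Fin n) | ‖y‖ ≤ (1 + n) * R ∧
      |⟪y, u⟫ - (t + m) * a| ≤ D * t ∧ |⟪y, w⟫ - (t + m) * b| ≤ D * t} :=
    isBounded_iff_forall_norm_le.2 ⟨_, fun y hy => hy.1⟩
  calc _ ≤ _ := ENNReal.toReal_mono hbdd.measure_lt_top.ne (measure_mono hslab)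
    _ ≤ C * (D * t) ^ 2 := hC _ _ _ (by positivity)
    _ = (C * D ^ 2) * t ^ 2 := by ring
    _ ≤ _ := by gcongr; exact le_abs_self _

lemma IsConvexBody.smul {n : ℕ} {K : Set (EuclideanSpace ℝ (Fin n))} (hK : IsConvexBody K)
    (t : ℝ) : IsConvexBody (t • K) :=
  ⟨hK.1.smul t, hK.2.1.smul t, hK.2.2.smul_set⟩

lemma IsSurfaceAreaMeasure.mixedVol_smul {n : ℕ} {K : Set (EuclideanSpace ℝ (Fin n))}
    {μ : Measure (Metric.sphere (0 : EuclideanSpace ℝ (Fin n)) 1)}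
    (hμ : IsSurfaceAreaMeasure n K μ) {L : Set (EuclideanSpace ℝ (Fin n))}
    (hL : IsConvexBody L) {t : ℝ} (ht : 0 ≤ t) :
    mixedVol n (fun j : Fin n => if (j : ℕ) = 0 then t • L else K) =
      t * mixedVol n (fun j : Fin n => if (j : ℕ) = 0 then L else K) := by
  rw [hμ _ (hL.smul t), hμ _ hL]
  simp only [suppFn_smul L ht, integral_const_mul]
  ring

lemma IsSurfaceAreaMeasure.notMem_msupport {n : ℕ} (hn : 1 ≤ n)
    {s : Finset (EuclideanSpace ℝ (Fin n))} {K : Set (EuclideanSpace ℝ (Fin n))}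
    (hKs : K = convexHull ℝ (s : Set (EuclideanSpace ℝ (Fin n))))
    (hK : IsConvexBody K) (hint : (interior K).Nonempty)
    {ν : Measure (Metric.sphere (0 : EuclideanSpace ℝ (Fin n)) 1)}
    (hν : IsSurfaceAreaMeasure n K ν) (u : Metric.sphere (0 : EuclideanSpace ℝ (Fin n)) 1)
    {w : EuclideanSpace ℝ (Fin n)} (hw : ‖w‖ = 1) (huw : ⟪(u : EuclideanSpace ℝ (Fin n)), w⟫ = 0)
    {b : ℝ} (hface : ∀ a ∈ s, ⟪a, (u : EuclideanSpace ℝ (Fin n))⟫ = suppFn K u → ⟪a, w⟫ = b) :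
    u ∉ msupport ν := by
  classical
  have := hν.isFiniteMeasure hn hK hint
  have hu : ‖(u : EuclideanSpace ℝ (Fin n))‖ = 1 := by simp
  set A := s.filter fun a => ⟪a, (u : EuclideanSpace ℝ (Fin n))⟫ = suppFn K u
  set B := s.filter fun a => ¬ ⟪a, (u : EuclideanSpace ℝ (Fin n))⟫ = suppFn K u
  have hAB : A ∪ B = s := Finset.filter_union_filter_not_eq _ s
  have hsne : s.Nonempty :=
      Finset.coe_nonempty.1 (convexHull_nonempty_iff.1 (hKs ▸ hK.2.2))
  have hAne : A.Nonempty := by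
    obtain ⟨a, ha, hau⟩ := exists_vertex_inner_eq_suppFn hsne (u : EuclideanSpace ℝ (Fin n))
    exact ⟨a, Finset.mem_filter.2 ⟨ha, by rw [hau, hKs]⟩⟩
  set F := convexHull ℝ (A : Set (EuclideanSpace ℝ (Fin n)))
  set L := convexHull ℝ (B : Set (EuclideanSpace ℝ (Fin n)))
  have hFu : ∀ f ∈ F, ⟪f, (u : EuclideanSpace ℝ (Fin n))⟫ = suppFn K u := fun f hf =>
    convexHull_min (fun a ha => (Finset.mem_filter.1 ha).2)
      (convex_hyperplane (isLinearMap_inner_left (u : EuclideanSpace ℝ (Fin n))) _) hf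
  have hFw : ∀ f ∈ F, ⟪f, w⟫ = b := fun f hf =>
    convexHull_min
      (fun a ha => hface a (Finset.mem_filter.1 ha).1 (Finset.mem_filter.1 ha).2)
      (convex_hyperplane (isLinearMap_inner_left w) _) hf
  have hBne : B.Nonempty := by
    by_contra hB
    rw [Finset.not_nonempty_iff_eq_empty] at hB
    rw [hB, Finset.union_empty] at hAB
    obtain ⟨x, hx, hxu⟩ := exists_mem_inner_lt_suppFn hK.2.1 hint hu
    rw [hKs, ← hAB] at hx
    exact hxu.ne (hFu x hx)
  have hFK : F ⊆ K := hKs ▸ convexHull_mono (by exact_mod_cast Finset.filter_subset _ s)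
  have hLK : L ⊆ K := hKs ▸ convexHull_mono (by exact_mod_cast Finset.filter_subset _ s)
  have hLc : IsCompact L := B.finite_toSet.isCompact_convexHull (𝕜 := ℝ)
  have hL : IsConvexBody L := ⟨convex_convexHull _ _, hLc, (Finset.coe_nonempty.2 hBne).convexHull⟩
  have hdec : ∀ k ∈ K, ∃ f ∈ F, ∃ g ∈ L, ∃ θ : ℝ, 0 ≤ θ ∧ θ ≤ 1 ∧
      k = (1 - θ) • f + θ • g := by
    intro k hk
    rw [hKs, ← hAB, Finset.coe_union,
      convexHull_union (Finset.coe_nonempty.2 hAne) (Finset.coe_nonempty.2 hBne),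
      mem_convexJoin] at hk
    obtain ⟨f, hf, g, hg, x, θ, hx, hθ, hxθ, rfl⟩ := hk
    exact ⟨f, hf, g, hg, θ, hθ, by linarith, by rw [← hxθ]; simp⟩
  obtain ⟨C, hC0, hC⟩ := exists_volume_sub_le hK hLc hLK hFK hdec hu hw huw hFu hFw
  set M := ((n.factorial : ℝ))⁻¹ * ∑ _S : Finset (Fin n), C
  set d := mixedVol n (fun j : Fin n => if (j : ℕ) = 0 then K else K) -
    mixedVol n (fun j : Fin n => if (j : ℕ) = 0 then L else K)
  have hM : 0 ≤ M := mul_nonneg (by positivity) (Finset.sum_nonneg fun _ _ => hC0)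
  have hquad : ∀ t : ℝ, 0 ≤ t → t ≤ 1 → t * |d| ≤ M * t ^ 2 := by
    intro t ht ht1
    rw [← abs_of_nonneg ht, ← abs_mul, abs_of_nonneg ht, mul_sub, ← hν.mixedVol_smul hK ht,
      ← hν.mixedVol_smul hL ht, mixedVol, mixedVol, ← mul_sub, ← Finset.sum_sub_distrib, abs_mul,
      abs_of_nonneg (by positivity), mul_assoc, Finset.sum_mul]
    gcongr
    refine (Finset.abs_sum_le_sum_abs _ _).trans (Finset.sum_le_sum fun S _ => ?_)
    rw [← mul_sub, abs_mul, abs_pow, abs_neg, abs_one, one_pow, one_mul]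
    obtain ⟨m, hm, hmn, h | h⟩ := sum_ite_eq_add_smul hn hK.1 hK.2.2 S
    · rw [h, h]
      exact hC t m ht ht1 hm hmn
    · rw [h, h, sub_self, abs_zero]
      positivity
  have hd : d = 0 := by
    have h1 := hquad 1 zero_le_one le_rfl
    have h2 := hquad (|d| / (M + 1)) (by positivity) (by
      rw [div_le_one (by positivity)]; linarith)
    have h3 : |d| ^ 2 * (M + 1) ≤ M * |d| ^ 2 := by
      have : 0 < M + 1 := by positivity
      field_simp at h2
      linarith
    have : |d| ^ 2 ≤ 0 := by linarith
    simpa using le_antisymm this (by positivity)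
  have hIK := integrable_suppFn hK.2.1 ν
  have hIL := integrable_suppFn hLc ν
  have hint0 : ∫ v : Metric.sphere (0 : EuclideanSpace ℝ (Fin n)) 1,
      (suppFn K (v : EuclideanSpace ℝ (Fin n)) - suppFn L (v : EuclideanSpace ℝ (Fin n))) ∂ν
        = 0 := by
    rw [integral_sub hIK hIL]
    simp only [d, hν K hK, hν L hL, ← mul_sub] at hd
    have hn0 : (n : ℝ) ≠ 0 := by positivity
    simpa [hn0] using hd
  rw [integral_eq_zero_iff_of_nonneg (fun v => sub_nonneg.2 (suppFn_le hL.2.2 fun x hx =>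
    inner_le_suppFn hK.2.1 (hLK hx) _)) (hIK.sub hIL)] at hint0
  intro hmem
  refine hmem {v | suppFn L (v : EuclideanSpace ℝ (Fin n)) < suppFn K v}
    (isOpen_lt ((continuous_suppFn hLc).comp continuous_subtype_val)
      ((continuous_suppFn hK.2.1).comp continuous_subtype_val)) ?_ ?_
  · obtain ⟨x, hx, hxu⟩ := exists_inner_eq_suppFn hLc hL.2.2 (u : EuclideanSpace ℝ (Fin n))
    show suppFn L (u : EuclideanSpace ℝ (Fin n)) < suppFn K u
    rw [← hxu]
    refine convexHull_min (fun a ha => ?_)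
      (convex_halfSpace_lt (isLinearMap_inner_left (u : EuclideanSpace ℝ (Fin n))) _) hx
    exact lt_of_le_of_ne (inner_le_suppFn hK.2.1 (hLK (subset_convexHull ℝ _ ha)) _)
      (Finset.mem_filter.1 ha).2
  · refine measure_mono_null (fun v hv => ?_) (ae_iff.1 hint0)
    exact (sub_pos.2 hv).ne'

lemma IsSurfaceAreaMeasure.eq_of_face_subset {n : ℕ} (hn : 1 ≤ n)
    {s : Finset (EuclideanSpace ℝ (Fin n))} {K : Set (EuclideanSpace ℝ (Fin n))}
    (hKs : K = convexHull ℝ (s : Set (EuclideanSpace ℝ (Fin n))))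
    (hK : IsConvexBody K) (hint : (interior K).Nonempty)
    {ν : Measure (Metric.sphere (0 : EuclideanSpace ℝ (Fin n)) 1)}
    (hν : IsSurfaceAreaMeasure n K ν) {u v : Metric.sphere (0 : EuclideanSpace ℝ (Fin n)) 1}
    (hu : u ∈ msupport ν)
    (hface : ∀ a ∈ s, ⟪a, (u : EuclideanSpace ℝ (Fin n))⟫ = suppFn K u →
      ⟪a, (v : EuclideanSpace ℝ (Fin n))⟫ = suppFn K v) : u = v := by
  set u' : EuclideanSpace ℝ (Fin n) := u.1 with hu'
  set v' : EuclideanSpace ℝ (Fin n) := v.1 with hv'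
  have hu1 : ‖u'‖ = 1 := by simp [u']
  have hv1 : ‖v'‖ = 1 := by simp [v']
  by_cases hz : v' = ⟪u', v'⟫ • u'
  · have hc : |⟪u', v'⟫| = 1 := by
      have := congrArg norm hz
      rwa [norm_smul, hu1, hv1, mul_one, Real.norm_eq_abs, eq_comm] at this
    rcases eq_or_eq_neg_of_abs_eq hc with hc | hc
    · rw [hc, one_smul] at hz
      exact Subtype.ext hz.symm
    · rw [hc, neg_one_smul] at hz
      have hsne : s.Nonempty :=
      Finset.coe_nonempty.1 (convexHull_nonempty_iff.1 (hKs ▸ hK.2.2))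
      obtain ⟨a, ha, hau⟩ := exists_vertex_inner_eq_suppFn hsne u'
      rw [← hKs] at hau
      have hav := hface a ha hau
      obtain ⟨x, hx, hxu⟩ := exists_mem_inner_lt_suppFn hK.2.1 hint hu1
      have hxv := inner_le_suppFn hK.2.1 hx v'
      rw [← hav, hz, inner_neg_right, inner_neg_right] at hxv
      linarith
  · have hw : v' - ⟪u', v'⟫ • u' ≠ 0 := sub_ne_zero.2 hz
    refine absurd hu (hν.notMem_msupport hn hKs hK hint u
      (w := ‖v' - ⟪u', v'⟫ • u'‖⁻¹ • (v' - ⟪u', v'⟫ • u'))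
      (b := ‖v' - ⟪u', v'⟫ • u'‖⁻¹ * (suppFn K v' - ⟪u', v'⟫ * suppFn K u'))
      (norm_smul_inv_norm hw) ?_ fun a ha hau => ?_)
    · rw [← hu', real_inner_smul_right, inner_sub_right, real_inner_smul_right,
        real_inner_self_eq_norm_sq, hu1]
      ring
    · rw [real_inner_smul_right, inner_sub_right, real_inner_smul_right, hface a ha hau, hau]

lemma IsSurfaceAreaMeasure.finite_msupport {n : ℕ} (hn : 1 ≤ n)
    {s : Finset (EuclideanSpace ℝ (Fin n))} {K : Set (EuclideanSpace ℝ (Fin n))}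
    (hKs : K = convexHull ℝ (s : Set (EuclideanSpace ℝ (Fin n))))
    (hK : IsConvexBody K) (hint : (interior K).Nonempty)
    {ν : Measure (Metric.sphere (0 : EuclideanSpace ℝ (Fin n)) 1)}
    (hν : IsSurfaceAreaMeasure n K ν) : (msupport ν).Finite := by
  classical
  refine Set.Finite.of_finite_image (f := fun u : Metric.sphere (0 : EuclideanSpace ℝ (Fin n)) 1 =>
    s.filter fun a => ⟪a, (u : EuclideanSpace ℝ (Fin n))⟫ = suppFn K u) ?_ ?_
  · refine (s.powerset.finite_toSet).subset ?_
    rintro _ ⟨u, -, rfl⟩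
    exact Finset.mem_coe.2 (Finset.mem_powerset.2 (Finset.filter_subset _ _))
  · intro u hu v _ huv
    refine hν.eq_of_face_subset hn hKs hK hint hu fun a ha hau => ?_
    have : a ∈ s.filter fun a => ⟪a, (u : EuclideanSpace ℝ (Fin n))⟫ = suppFn K u :=
      Finset.mem_filter.2 ⟨ha, hau⟩
    simp only at huv
    rw [huv] at this
    exact (Finset.mem_filter.1 this).2

/-- Each facet of a polytope contains a point lying on no other facet. -/
lemma IsSurfaceAreaMeasure.exists_mem_facet_inner_lt {n : ℕ} (hn : 1 ≤ n)
    {s : Finset (EuclideanSpace ℝ (Fin n))} {K : Set (EuclideanSpace ℝ (Fin n))}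
    (hKs : K = convexHull ℝ (s : Set (EuclideanSpace ℝ (Fin n))))
    (hK : IsConvexBody K) (hint : (interior K).Nonempty)
    {ν : Measure (Metric.sphere (0 : EuclideanSpace ℝ (Fin n)) 1)}
    (hν : IsSurfaceAreaMeasure n K ν) {u : Metric.sphere (0 : EuclideanSpace ℝ (Fin n)) 1}
    (hu : u ∈ msupport ν) :
    ∃ x : EuclideanSpace ℝ (Fin n), ⟪x, (u : EuclideanSpace ℝ (Fin n))⟫ = suppFn K u ∧
      ∀ v : Metric.sphere (0 : EuclideanSpace ℝ (Fin n)) 1, v ≠ u →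
        ⟪x, (v : EuclideanSpace ℝ (Fin n))⟫ < suppFn K v := by
  classical
  set A := s.filter fun a => ⟪a, (u : EuclideanSpace ℝ (Fin n))⟫ = suppFn K u
  have hAne : A.Nonempty := by
    have hsne : s.Nonempty :=
      Finset.coe_nonempty.1 (convexHull_nonempty_iff.1 (hKs ▸ hK.2.2))
    obtain ⟨a, ha, hau⟩ := exists_vertex_inner_eq_suppFn hsne (u : EuclideanSpace ℝ (Fin n))
    exact ⟨a, Finset.mem_filter.2 ⟨ha, by rw [hau, hKs]⟩⟩
  have hA0 : (0 : ℝ) < A.card := by exact_mod_cast hAne.card_pos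
  have hin : ∀ v : EuclideanSpace ℝ (Fin n),
      ⟪(A.card : ℝ)⁻¹ • ∑ a ∈ A, a, v⟫ = (A.card : ℝ)⁻¹ * ∑ a ∈ A, ⟪a, v⟫ := fun v => by
    rw [real_inner_smul_left, sum_inner]
  refine ⟨(A.card : ℝ)⁻¹ • ∑ a ∈ A, a, ?_, fun v hvu => ?_⟩
  · rw [hin, Finset.sum_congr rfl fun a ha => (Finset.mem_filter.1 ha).2, Finset.sum_const,
      nsmul_eq_mul, inv_mul_cancel_left₀ hA0.ne']
  · have hlt : ∑ a ∈ A, ⟪a, (v : EuclideanSpace ℝ (Fin n))⟫ < ∑ _a ∈ A, suppFn K v := by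
      have hle : ∀ a ∈ s, ⟪a, (v : EuclideanSpace ℝ (Fin n))⟫ ≤ suppFn K v := fun a ha =>
        inner_le_suppFn hK.2.1 (hKs ▸ subset_convexHull ℝ _ ha) _
      refine Finset.sum_lt_sum (fun a ha => hle a (Finset.mem_filter.1 ha).1) ?_
      by_contra! h
      refine hvu (hν.eq_of_face_subset hn hKs hK hint hu fun a ha hau => ?_).symm
      exact le_antisymm (hle a ha) (h a (Finset.mem_filter.2 ⟨ha, hau⟩))
    rw [Finset.sum_const, nsmul_eq_mul] at hlt
    rw [hin, inv_mul_lt_iff₀ hA0]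
    exact hlt

lemma integral_eq_sum_of_compl_null {α : Type*} [MeasurableSpace α] [MeasurableSingletonClass α]
    {μ : Measure α} (T : Finset α) (hT : μ (T : Set α)ᶜ = 0) {f : α → ℝ} (hf : Integrable f μ) :
    ∫ x, f x ∂μ = ∑ x ∈ T, μ.real {x} * f x := by
  rw [← setIntegral_univ, ← setIntegral_congr_set (s := (T : Set α)),
    setIntegral_finset T hf.integrableOn]
  · rfl
  · exact ae_eq_univ.2 hT

lemma measure_ext_of_compl_null {α : Type*} [MeasurableSpace α] [MeasurableSingletonClass α]
    {μ ν : Measure α} (T : Finset α) (hμ : μ (T : Set α)ᶜ = 0) (hν : ν (T : Set α)ᶜ = 0)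
    (h : ∀ x ∈ T, μ {x} = ν {x}) : μ = ν := by
  classical
  have key : ∀ ρ : Measure α, ρ (T : Set α)ᶜ = 0 → ∀ s : Set α,
      ρ s = ∑ x ∈ T.filter (· ∈ s), ρ {x} := by
    intro ρ hρ s
    rw [sum_measure_singleton, ← measure_inter_add_sdiff s T.measurableSet,
      measure_mono_null (s := s \ T) (fun x hx => hx.2) hρ, add_zero]
    congr 1
    ext x
    simp [and_comm]
  ext s _
  rw [key μ hμ, key ν hν]
  exact Finset.sum_congr rfl fun x hx => h x (Finset.mem_filter.1 hx).1

/-- Let `K, P` be `n`-polytopes with (1) `supp S(P,·) = supp S(K,·)`, (2) a constant `λ > 0`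
with `V(L,P[n-1]) ≤ λ V(L,K[n-1])` for all convex bodies `L`, and (3) `V(K,P[n-1]) = λ V_n(K)`.
Then `S(P,·) = λ S(K,·)`. -/
theorem surface_measures_proportional (n : ℕ) (hn : 1 ≤ n)
    (K P : Set (EuclideanSpace ℝ (Fin n)))
    (hK : IsConvexBody K) (hP : IsConvexBody P)
    (hKdim : (interior K).Nonempty) (hPdim : (interior P).Nonempty)
    (hKpoly : ∃ s : Finset (EuclideanSpace ℝ (Fin n)), K = convexHull ℝ (s : Set _))
    (hPpoly : ∃ s : Finset (EuclideanSpace ℝ (Fin n)), P = convexHull ℝ (s : Set _))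
    (μ ν : Measure (Metric.sphere (0 : EuclideanSpace ℝ (Fin n)) 1))
    (hμ : IsSurfaceAreaMeasure n P μ) (hν : IsSurfaceAreaMeasure n K ν)
    (hsupp : msupport μ = msupport ν)
    (lam : ℝ) (hlam : 0 < lam)
    (h2 : ∀ L : Set (EuclideanSpace ℝ (Fin n)), IsConvexBody L →
      mixedVol n (fun j : Fin n => if (j : ℕ) = 0 then L else P) ≤
        lam * mixedVol n (fun j : Fin n => if (j : ℕ) = 0 then L else K))
    (h3 : mixedVol n (fun j : Fin n => if (j : ℕ) = 0 then K else P)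
        = lam * mixedVol n (fun _ => K)) :
    μ = ENNReal.ofReal lam • ν := by
  classical
  obtain ⟨s, hKs⟩ := hKpoly
  have hsne : s.Nonempty :=
      Finset.coe_nonempty.1 (convexHull_nonempty_iff.1 (hKs ▸ hK.2.2))
  have := hμ.isFiniteMeasure hn hP hPdim
  have := hν.isFiniteMeasure hn hK hKdim
  have hfin := hν.finite_msupport hn hKs hK hKdim
  set T := hfin.toFinset
  have hTcoe : (T : Set (Metric.sphere (0 : EuclideanSpace ℝ (Fin n)) 1)) = msupport ν :=
    hfin.coe_toFinset
  have hμT : μ (T : Set (Metric.sphere (0 : EuclideanSpace ℝ (Fin n)) 1))ᶜ = 0 := by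
    rw [hTcoe, ← hsupp]
    exact measure_compl_msupport μ
  have hνT : ν (T : Set (Metric.sphere (0 : EuclideanSpace ℝ (Fin n)) 1))ᶜ = 0 := by
    rw [hTcoe]
    exact measure_compl_msupport ν
  have hVμ : ∀ L : Set (EuclideanSpace ℝ (Fin n)), IsConvexBody L →
      mixedVol n (fun j : Fin n => if (j : ℕ) = 0 then L else P) =
        1 / n * ∑ v ∈ T, μ.real {v} * suppFn L v := fun L hL => by
    rw [hμ L hL, integral_eq_sum_of_compl_null T hμT (integrable_suppFn hL.2.1 μ)]
  have hVν : ∀ L : Set (EuclideanSpace ℝ (Fin n)), IsConvexBody L →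
      mixedVol n (fun j : Fin n => if (j : ℕ) = 0 then L else K) =
        1 / n * ∑ v ∈ T, ν.real {v} * suppFn L v := fun L hL => by
    rw [hν L hL, integral_eq_sum_of_compl_null T hνT (integrable_suppFn hL.2.1 ν)]
  have hinv : (0 : ℝ) < 1 / n := by positivity
  have hdiff : ∀ L : Set (EuclideanSpace ℝ (Fin n)), IsConvexBody L →
      lam * mixedVol n (fun j : Fin n => if (j : ℕ) = 0 then L else K) -
        mixedVol n (fun j : Fin n => if (j : ℕ) = 0 then L else P) =
      1 / n * ∑ v ∈ T, (lam * ν.real {v} - μ.real {v}) * suppFn L v := fun L hL => by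
    rw [hVμ L hL, hVν L hL, mul_left_comm, ← mul_sub, Finset.mul_sum, ← Finset.sum_sub_distrib]
    exact congrArg _ (Finset.sum_congr rfl fun v _ => by ring)
  have hVKK : mixedVol n (fun j : Fin n => if (j : ℕ) = 0 then K else K) =
      mixedVol n (fun _ => K) := by simp
  have hle : ∀ u ∈ T, 0 ≤ lam * ν.real {u} - μ.real {u} := by
    intro u hu
    obtain ⟨x, hxu, hxlt⟩ :=
      hν.exists_mem_facet_inner_lt hn hKs hK hKdim (hfin.mem_toFinset.1 hu)
    have hev : ∀ᶠ ε : ℝ in nhdsWithin 0 (Set.Ioi 0), ∀ v ∈ T, v ≠ u →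
        ⟪x + ε • (u : EuclideanSpace ℝ (Fin n)), (v : EuclideanSpace ℝ (Fin n))⟫ < suppFn K v := by
      refine (Finset.eventually_all T).2 fun v _ => ?_
      by_cases hvu : v = u
      · simp [hvu]
      have hc : Continuous fun ε : ℝ =>
          ⟪x + ε • (u : EuclideanSpace ℝ (Fin n)), (v : EuclideanSpace ℝ (Fin n))⟫ := by fun_prop
      have := (hc.tendsto 0).eventually_lt_const (u := suppFn K v) (by simpa using hxlt v hvu)
      filter_upwards [this.filter_mono nhdsWithin_le_nhds] with ε hε _ using hε
    obtain ⟨ε, hε, hε0⟩ := (hev.and self_mem_nhdsWithin).exists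
    replace hε0 : 0 < ε := hε0
    set p := x + ε • (u : EuclideanSpace ℝ (Fin n))
    set L := convexHull ℝ (insert p (s : Set (EuclideanSpace ℝ (Fin n))))
    have hL : IsConvexBody L := ⟨convex_convexHull _ _,
      (s.finite_toSet.insert p).isCompact_convexHull (𝕜 := ℝ),
      (Set.insert_nonempty p _).convexHull⟩
    have hLs : ∀ v, suppFn L v = max (suppFn K v) ⟪p, v⟫ := fun v => by
      rw [hKs, suppFn_convexHull_insert s.finite_toSet (Finset.coe_nonempty.2 hsne)]
    have hLu : suppFn L u = suppFn K u + ε := by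
      have hpu : ⟪p, (u : EuclideanSpace ℝ (Fin n))⟫ = suppFn K u + ε := by
        simp [p, inner_add_left, real_inner_smul_left, hxu]
      rw [hLs, hpu]
      exact max_eq_right (by linarith)
    have hLv : ∀ v ∈ T, v ≠ u → suppFn L v = suppFn K v := fun v hv hvu => by
      rw [hLs]
      exact max_eq_left (hε v hv hvu).le
    have hsum : ∑ v ∈ T, (lam * ν.real {v} - μ.real {v}) * suppFn L v -
        ∑ v ∈ T, (lam * ν.real {v} - μ.real {v}) * suppFn K v =
        (lam * ν.real {u} - μ.real {u}) * ε := by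
      rw [← Finset.sum_sub_distrib, Finset.sum_eq_single_of_mem u hu, hLu]
      · ring
      · intro v hv hvu
        rw [hLv v hv hvu, sub_self]
    have h2L := sub_nonneg.2 (h2 L hL)
    have h3K := hdiff K hK
    rw [hdiff L hL] at h2L
    rw [h3, hVKK, sub_self] at h3K
    have h2L' := nonneg_of_mul_nonneg_right h2L hinv
    have h3K' := (mul_eq_zero.1 h3K.symm).resolve_left hinv.ne'
    rw [h3K', sub_zero] at hsum
    exact nonneg_of_mul_nonneg_left (hsum ▸ h2L') hε0
  obtain ⟨c, hK', r, hr, hpos⟩ := exists_suppFn_translate_pos hK hKdim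
  have hzero := hdiff _ hK'
  rw [mixedVol_singleton_add hn c K hK.1 hK.2.2, mixedVol_singleton_add hn c K hP.1 hP.2.2, h3,
    hVKK, sub_self] at hzero
  replace hzero := (mul_eq_zero.1 hzero.symm).resolve_left hinv.ne'
  have hpos' : ∀ v : Metric.sphere (0 : EuclideanSpace ℝ (Fin n)) 1,
      0 < suppFn ({c} + K) (v : EuclideanSpace ℝ (Fin n)) := fun v =>
    hr.trans_le (hpos v (by simp))
  rw [Finset.sum_eq_zero_iff_of_nonneg fun v hv => mul_nonneg (hle v hv) (hpos' v).le] at hzero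
  refine measure_ext_of_compl_null T hμT (by simp [hνT]) fun v hv => ?_
  have hv0 := (mul_eq_zero.1 (hzero v hv)).resolve_right (hpos' v).ne'
  rw [Measure.smul_apply, smul_eq_mul, ← ofReal_measureReal (μ := μ), ← ofReal_measureReal (μ := ν),
    ← ENNReal.ofReal_mul hlam.le, sub_eq_zero.1 hv0]
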